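/- Fix ε > 0 and an index i with 2 ≤ i ≤ N. Let A_1,…,A_N ∈ ℝ^P with mean Ā, and suppose there is a constant η > 0 such that ‖A_i‖ + ‖A_j‖ + ε ≥ η for all j < i. Define ℓ₂(u,v) = ‖u − v‖ / (‖u‖ + ‖v‖ + ε). Then the trace of the empirical attention covariance is bounded below in terms of the average normalized distance from A_i to the previous samples: (1/N) Σ_{p=1}^N ‖A_p − Ā‖² ≥ ((i−1)/N²) · η² · ((1/(i−1)) Σ_{j<i} ℓ₂(A_i, A_j))². In particular, increasing the average normalized distance E_{j<i}[ℓ₂(A_i, A_j)] (equivalently, decreasing the similarity loss L_S = 1 − E_{j<i}[ℓ₂(A_i, A_j)]) enlarges a lower bound on the intra-class attention diversity. -/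

import Mathlib

/-- For a centred family, the squared distances to one member sum to at most the
cardinality times the total squared norm. -/
theorem sum_norm_sub_sq_le_card_mul_of_sum_eq_zero {ι E : Type*} [NormedAddCommGroup E]
    [InnerProductSpace ℝ E] (s : Finset ι) (b : ι → E) (hb : ∑ j ∈ s, b j = 0)
    {i : ι} (hi : i ∈ s) :
    ∑ j ∈ s, ‖b i - b j‖ ^ 2 ≤ (s.card : ℝ) * ∑ j ∈ s, ‖b j‖ ^ 2 := by
  classical
  have hexp : ∑ j ∈ s, ‖b i - b j‖ ^ 2 = (s.card : ℝ) * ‖b i‖ ^ 2 + ∑ j ∈ s, ‖b j‖ ^ 2 := by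
    simp only [norm_sub_sq_real, Finset.sum_add_distrib, Finset.sum_sub_distrib,
      ← Finset.mul_sum, ← inner_sum, hb, inner_zero_right, Finset.sum_const, nsmul_eq_mul]
    ring
  have hsum : ∑ j ∈ s, ‖b j‖ ^ 2 = ‖b i‖ ^ 2 + ∑ j ∈ s.erase i, ‖b j‖ ^ 2 :=
    (Finset.add_sum_erase s (fun j => ‖b j‖ ^ 2) hi).symm
  have hnorm : ‖b i‖ ≤ ∑ j ∈ s.erase i, ‖b j‖ := by
    have h : b i = -∑ j ∈ s.erase i, b j := by
      rw [eq_neg_iff_add_eq_zero, Finset.add_sum_erase s b hi, hb]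
    rw [h, norm_neg]
    exact norm_sum_le _ _
  have hcard : ((s.erase i).card : ℝ) = s.card - 1 := by
    rw [Finset.cast_card_erase_of_mem hi]
  have hsq : ‖b i‖ ^ 2 ≤ ((s.card : ℝ) - 1) * ∑ j ∈ s.erase i, ‖b j‖ ^ 2 := by
    rw [← hcard]
    exact (pow_le_pow_left₀ (norm_nonneg _) hnorm 2).trans sq_sum_le_card_mul_sum_sq
  rw [hexp, hsum]
  linarith

/-- For `ε > 0`, an index `i` with `2 ≤ i ≤ N`, attention maps
`A_1,…,A_N ∈ ℝ^P` with mean `Ā`, and `η > 0` with `‖A_i‖ + ‖A_j‖ + ε ≥ η`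
for all `j < i`, the trace of the empirical attention covariance is bounded
below in terms of the average normalized distance from `A_i` to the previous
samples:
`(1/N) Σ_p ‖A_p − Ā‖² ≥ ((i−1)/N²) · η² · ((1/(i−1)) Σ_{j<i} ℓ₂(A_i, A_j))²`,
where `ℓ₂(u,v) = ‖u − v‖ / (‖u‖ + ‖v‖ + ε)`. -/
theorem stmt12 {P : ℕ} (ε : ℝ) (hε : 0 < ε) (N i : ℕ) (hi : 2 ≤ i) (hiN : i ≤ N)
    (A : ℕ → EuclideanSpace ℝ (Fin P))
    (Abar : EuclideanSpace ℝ (Fin P))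
    (hAbar : Abar = (1 / (N : ℝ)) • ∑ p ∈ Finset.Icc 1 N, A p)
    (η : ℝ) (hη : 0 < η)
    (hbound : ∀ j ∈ Finset.Icc 1 (i - 1), η ≤ ‖A i‖ + ‖A j‖ + ε)
    (ℓ₂ : EuclideanSpace ℝ (Fin P) → EuclideanSpace ℝ (Fin P) → ℝ)
    (hℓ₂ : ∀ u v, ℓ₂ u v = ‖u - v‖ / (‖u‖ + ‖v‖ + ε)) :
    (1 / (N : ℝ)) * ∑ p ∈ Finset.Icc 1 N, ‖A p - Abar‖ ^ 2
      ≥ (((i : ℝ) - 1) / (N : ℝ) ^ 2) * η ^ 2 *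
          ((1 / ((i : ℝ) - 1)) * ∑ j ∈ Finset.Icc 1 (i - 1), ℓ₂ (A i) (A j)) ^ 2 := by
  have hN : (0 : ℝ) < N := by
    exact_mod_cast (by omega : 0 < N)
  have hm : (0 : ℝ) < (i : ℝ) - 1 := by
    have : (2 : ℝ) ≤ i := by exact_mod_cast hi
    linarith
  have hcentred : ∑ p ∈ Finset.Icc 1 N, (A p - Abar) = 0 := by
    rw [Finset.sum_sub_distrib, Finset.sum_const, Nat.card_Icc, Nat.add_sub_cancel, hAbar,
      ← Nat.cast_smul_eq_nsmul ℝ, smul_smul, mul_one_div_cancel hN.ne', one_smul, sub_self]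
  have hdist := sum_norm_sub_sq_le_card_mul_of_sum_eq_zero (Finset.Icc 1 N)
    (fun p => A p - Abar) hcentred (i := i) (Finset.mem_Icc.mpr ⟨by omega, hiN⟩)
  simp only [sub_sub_sub_cancel_right, Nat.card_Icc, Nat.add_sub_cancel] at hdist
  have hsub : ∑ j ∈ Finset.Icc 1 (i - 1), ‖A i - A j‖ ^ 2
      ≤ ∑ j ∈ Finset.Icc 1 N, ‖A i - A j‖ ^ 2 :=
    Finset.sum_le_sum_of_subset_of_nonneg (Finset.Icc_subset_Icc_right (by omega))
      fun _ _ _ => sq_nonneg _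
  have hterm : η ^ 2 * ∑ j ∈ Finset.Icc 1 (i - 1), ℓ₂ (A i) (A j) ^ 2
      ≤ ∑ j ∈ Finset.Icc 1 (i - 1), ‖A i - A j‖ ^ 2 := by
    rw [Finset.mul_sum]
    refine Finset.sum_le_sum fun j hj => ?_
    have hden : 0 < ‖A i‖ + ‖A j‖ + ε := hη.trans_le (hbound j hj)
    rw [← mul_pow, hℓ₂]
    refine pow_le_pow_left₀ (by positivity) ?_ 2
    rw [mul_div_assoc', div_le_iff₀ hden, mul_comm]
    exact mul_le_mul_of_nonneg_left (hbound j hj) (norm_nonneg _)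
  have hcs : (∑ j ∈ Finset.Icc 1 (i - 1), ℓ₂ (A i) (A j)) ^ 2
      ≤ ((i : ℝ) - 1) * ∑ j ∈ Finset.Icc 1 (i - 1), ℓ₂ (A i) (A j) ^ 2 := by
    have h := sq_sum_le_card_mul_sum_sq (s := Finset.Icc 1 (i - 1)) (f := fun j => ℓ₂ (A i) (A j))
    rwa [Nat.card_Icc, Nat.add_sub_cancel, Nat.cast_sub (by omega), Nat.cast_one] at h
  set S := ∑ p ∈ Finset.Icc 1 N, ‖A p - Abar‖ ^ 2
  set L := ∑ j ∈ Finset.Icc 1 (i - 1), ℓ₂ (A i) (A j)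
  set Q := ∑ j ∈ Finset.Icc 1 (i - 1), ℓ₂ (A i) (A j) ^ 2
  calc ((i : ℝ) - 1) / (N : ℝ) ^ 2 * η ^ 2 * (1 / ((i : ℝ) - 1) * L) ^ 2
      = η ^ 2 / ((N : ℝ) ^ 2 * ((i : ℝ) - 1)) * L ^ 2 := by field_simp
    _ ≤ η ^ 2 / ((N : ℝ) ^ 2 * ((i : ℝ) - 1)) * (((i : ℝ) - 1) * Q) := by gcongr
    _ = 1 / (N : ℝ) ^ 2 * (η ^ 2 * Q) := by field_simp
    _ ≤ 1 / (N : ℝ) ^ 2 * (N * S) :=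
        mul_le_mul_of_nonneg_left (hterm.trans (hsub.trans hdist)) (by positivity)
    _ = 1 / (N : ℝ) * S := by field_simp
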